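/- arXiv:2012.01216 — 2 statements merged into one kernel-verified Lean document; each statement's English description precedes it below -/
import Mathlib

section
/- (Lemma 1, non-strict form.) Let A and B be nonempty compact convex subsets of ℝ² whose interiors share a common point, i.e. (interior A ∩ interior B) is nonempty. Then μH¹(frontier (convexHull ℝ (A ∪ B))) ≤ μH¹(frontier A) + μH¹(frontier B): the perimeter of the convex hull of A ∪ B is at most the sum of the perimeters of A and B. -/
open MeasureTheory

/-- The perimeter of a set in the Euclidean plane: the one-dimensional Hausdorff
measure of its topological frontier. -/
noncomputable def perim (s : Set (EuclideanSpace ℝ (Fin 2))) : ℝ :=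
  (μH[1] (frontier s)).toReal

open scoped RealInnerProductSpace ENNReal

/-- The Euclidean plane. -/
local notation "E²" => EuclideanSpace ℝ (Fin 2)

section Plane

/-- Rotation of a plane vector by a quarter turn. -/
noncomputable def quarterTurn (n : E²) : E² := !₂[-n 1, n 0]

theorem inner_quarterTurn_self (n : E²) : ⟪quarterTurn n, n⟫ = 0 := by
  simp [quarterTurn, PiLp.inner_apply, Fin.sum_univ_two]
  ring

theorem eq_of_inner_eq_of_inner_quarterTurn_eq {n y z : E²} (hn : n ≠ 0)
    (h : ⟪n, y⟫ = ⟪n, z⟫) (h' : ⟪quarterTurn n, y⟫ = ⟪quarterTurn n, z⟫) : y = z := by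
  simp only [quarterTurn, PiLp.inner_apply, Fin.sum_univ_two] at h h'
  simp at h h'
  have hpos : n 0 ^ 2 + n 1 ^ 2 ≠ 0 := by
    intro h0
    apply hn
    ext i
    fin_cases i
    · simp; nlinarith [sq_nonneg (n 0), sq_nonneg (n 1)]
    · simp; nlinarith [sq_nonneg (n 0), sq_nonneg (n 1)]
  have h0 : y 0 = z 0 := mul_left_cancel₀ hpos (by linear_combination n 0 * h - n 1 * h')
  have h1 : y 1 = z 1 := mul_left_cancel₀ hpos (by linear_combination n 1 * h + n 0 * h')
  ext i
  fin_cases i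
  exacts [h0, h1]

end Plane

section Support

variable {E : Type*} [NormedAddCommGroup E] [InnerProductSpace ℝ E] [CompleteSpace E]

theorem Convex.exists_inner_le_of_mem_frontier {K : Set E} (hK : Convex ℝ K)
    (hne : (interior K).Nonempty) {x : E} (hx : x ∈ frontier K) :
    ∃ n : E, (∀ y ∈ interior K, ⟪n, y⟫ < ⟪n, x⟫) ∧ ∀ y ∈ K, ⟪n, y⟫ ≤ ⟪n, x⟫ := by
  obtain ⟨f, hf⟩ := geometric_hahn_banach_open_point hK.interior isOpen_interior hx.2
  obtain ⟨n, rfl⟩ := (InnerProductSpace.toDual ℝ E).surjective f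
  simp only [InnerProductSpace.toDual_apply_apply] at hf
  refine ⟨n, hf, fun y hy => ?_⟩
  have hy' : y ∈ closure (interior K) := by
    rw [hK.closure_interior_eq_closure_of_nonempty_interior hne]
    exact subset_closure hy
  have hcl : IsClosed {y : E | ⟪n, y⟫ ≤ ⟪n, x⟫} := isClosed_le (by fun_prop) (by fun_prop)
  exact closure_minimal (fun z hz => (hf z hz).le) hcl hy'

theorem exists_mem_inner_eq_of_mem_convexHull {E : Type*} [NormedAddCommGroup E]
    [InnerProductSpace ℝ E] {U : Set E} {n x : E} {c : ℝ} (hx : x ∈ convexHull ℝ U)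
    (hU : ∀ y ∈ U, ⟪n, y⟫ ≤ c) (hxc : ⟪n, x⟫ = c) (v : E) :
    ∃ a ∈ U, ⟪n, a⟫ = c ∧ ⟪v, a⟫ ≤ ⟪v, x⟫ := by
  by_contra! hcon
  have hsub : U ⊆ {y | ⟪n, y⟫ < c ∨ ⟪n, y⟫ = c ∧ ⟪v, x⟫ < ⟪v, y⟫} := fun y hy => by
    rcases (hU y hy).lt_or_eq with h | h
    · exact Or.inl h
    · exact Or.inr ⟨h, hcon y hy h⟩
  have hconv : Convex ℝ {y | ⟪n, y⟫ < c ∨ ⟪n, y⟫ = c ∧ ⟪v, x⟫ < ⟪v, y⟫} := by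
    rw [convex_iff_forall_pos]
    intro y hy z hz s t hs ht hst
    simp only [Set.mem_ofPred_eq, inner_add_right, real_inner_smul_right] at hy hz ⊢
    obtain rfl : s = 1 - t := by linarith
    rcases hy with hy | ⟨hy, hy'⟩ <;> rcases hz with hz | ⟨hz, hz'⟩
    · left; nlinarith
    · left; nlinarith
    · left; nlinarith
    · right
      constructor
      · rw [hy, hz]; ring
      · nlinarith
  rcases convexHull_min hsub hconv hx with h | ⟨-, h⟩
  · exact h.ne hxc
  · exact lt_irrefl _ h

end Support

/-- The line `⟪n, y⟫ = 1` supports `U`, and it meets `U` at positions `α` and `β`, measured along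
the line, but nowhere between them. -/
structure IsBridge (U : Set E²) (n : E²) (α β : ℝ) : Prop where
  lt : α < β
  inner_le : ∀ y ∈ U, ⟪n, y⟫ ≤ 1
  exists_left : ∃ a ∈ U, ⟪n, a⟫ = 1 ∧ ⟪quarterTurn n, a⟫ = α
  exists_right : ∃ b ∈ U, ⟪n, b⟫ = 1 ∧ ⟪quarterTurn n, b⟫ = β
  gap : ∀ y ∈ U, ⟪n, y⟫ = 1 → α < ⟪quarterTurn n, y⟫ → β ≤ ⟪quarterTurn n, y⟫

/-- The open segment of the line `⟪n, y⟫ = 1` between positions `α` and `β`. -/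
def bridgeSegment (n : E²) (α β : ℝ) : Set E² :=
  {y | ⟪n, y⟫ = 1 ∧ α < ⟪quarterTurn n, y⟫ ∧ ⟪quarterTurn n, y⟫ < β}

/-- The open triangle spanned by the origin and `bridgeSegment n α β`. -/
def bridgeTriangle (n : E²) (α β : ℝ) : Set E² :=
  {y | 0 < ⟪n, y⟫ ∧ ⟪n, y⟫ < 1 ∧ α * ⟪n, y⟫ < ⟪quarterTurn n, y⟫ ∧
    ⟪quarterTurn n, y⟫ < β * ⟪n, y⟫}

theorem isOpen_bridgeTriangle (n : E²) (α β : ℝ) : IsOpen (bridgeTriangle n α β) := by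
  simp only [bridgeTriangle, Set.ofPred_and]
  refine IsOpen.inter ?_ (IsOpen.inter ?_ (IsOpen.inter ?_ ?_)) <;>
    exact isOpen_lt (by fun_prop) (by fun_prop)

theorem inv_smul_mem_bridgeSegment {n y : E²} {α β : ℝ} (hy : y ∈ bridgeTriangle n α β) :
    (⟪n, y⟫)⁻¹ • y ∈ bridgeSegment n α β := by
  obtain ⟨h0, -, h2, h3⟩ := hy
  simp only [bridgeSegment, Set.mem_ofPred_eq, real_inner_smul_right]
  refine ⟨inv_mul_cancel₀ h0.ne', ?_, ?_⟩
  · rwa [inv_mul_eq_div, lt_div_iff₀ h0]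
  · rwa [inv_mul_eq_div, div_lt_iff₀ h0]

theorem smul_mem_bridgeTriangle {n x : E²} {α β t : ℝ} (hx : x ∈ bridgeSegment n α β)
    (ht : 0 < t) (ht1 : t < 1) : t • x ∈ bridgeTriangle n α β := by
  obtain ⟨h1, h2, h3⟩ := hx
  simp only [bridgeTriangle, Set.mem_ofPred_eq, real_inner_smul_right, h1]
  refine ⟨by linarith, by linarith, by nlinarith, by nlinarith⟩

theorem exists_isBridge {U : Set E²} (hU : IsCompact U) {n x : E²} (hx : x ∈ convexHull ℝ U)
    (hxU : x ∉ U) (hn : ∀ y ∈ U, ⟪n, y⟫ ≤ 1) (hnx : ⟪n, x⟫ = 1) :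
    ∃ α β, IsBridge U n α β ∧ x ∈ bridgeSegment n α β := by
  have hn0 : n ≠ 0 := by
    rintro rfl
    simp at hnx
  have extremal : ∀ v : E², (∀ y, ⟪n, y⟫ = ⟪n, x⟫ → ⟪v, y⟫ = ⟪v, x⟫ → y = x) →
      ∃ a ∈ U, ⟪n, a⟫ = 1 ∧ ⟪v, a⟫ < ⟪v, x⟫ ∧
        ∀ y ∈ U, ⟪n, y⟫ = 1 → ⟪v, y⟫ ≤ ⟪v, x⟫ → ⟪v, y⟫ ≤ ⟪v, a⟫ := by
    intro v hv
    have hc : IsCompact (U ∩ {y | ⟪n, y⟫ = 1 ∧ ⟪v, y⟫ ≤ ⟪v, x⟫}) := by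
      rw [Set.ofPred_and]
      exact hU.inter_right ((isClosed_eq (by fun_prop) (by fun_prop)).inter
        (isClosed_le (by fun_prop) (by fun_prop)))
    obtain ⟨a₀, ha₀, ha₀'⟩ := exists_mem_inner_eq_of_mem_convexHull hx hn hnx v
    obtain ⟨a, ⟨haU, ha1, hax⟩, hmax⟩ := hc.exists_isMaxOn ⟨a₀, ha₀, ha₀'⟩
      (f := fun y => ⟪v, y⟫) (by fun_prop)
    refine ⟨a, haU, ha1, lt_of_le_of_ne hax fun h => ?_, fun y hy hy1 hyx => hmax ⟨hy, hy1, hyx⟩⟩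
    exact hxU (hv a (ha1.trans hnx.symm) h ▸ haU)
  obtain ⟨a, haU, ha1, hax, ha⟩ := extremal (quarterTurn n) fun y h h' =>
    eq_of_inner_eq_of_inner_quarterTurn_eq hn0 h h'
  obtain ⟨b, hbU, hb1, hbx, hb⟩ := extremal (-quarterTurn n) fun y h h' =>
    eq_of_inner_eq_of_inner_quarterTurn_eq hn0 h (by simpa using h')
  simp only [inner_neg_left, neg_lt_neg_iff, neg_le_neg_iff] at hbx hb
  refine ⟨_, _, ⟨hax.trans hbx, hn, ⟨a, haU, ha1, rfl⟩, ⟨b, hbU, hb1, rfl⟩, ?_⟩, hnx, hax, hbx⟩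
  intro y hy hy1 hay
  by_contra! hyb
  rcases le_total ⟪quarterTurn n, y⟫ ⟪quarterTurn n, x⟫ with h | h
  · exact (ha y hy hy1 h).not_gt hay
  · exact (hb y hy hy1 h).not_gt hyb

namespace IsBridge

variable {U : Set E²} {n n' : E²} {α β α' β' : ℝ}

theorem ne_zero (h : IsBridge U n α β) : n ≠ 0 := by
  rintro rfl
  obtain ⟨a, -, ha, -⟩ := h.exists_left
  simp at ha

theorem inner_le_of_mem_convexHull (h : IsBridge U n α β) {y : E²} (hy : y ∈ convexHull ℝ U) :
    ⟪n, y⟫ ≤ 1 :=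
  convexHull_min (t := {y | ⟪n, y⟫ ≤ 1}) h.inner_le
    (convex_halfSpace_le (innerₛₗ ℝ n).isLinear 1) hy

theorem exists_mem_openSegment (h : IsBridge U n α β) {x : E²} (hx : x ∈ bridgeSegment n α β) :
    ∃ a ∈ U, ∃ b ∈ U, ⟪n, a⟫ = 1 ∧ ⟪quarterTurn n, a⟫ = α ∧ ⟪n, b⟫ = 1 ∧
      ⟪quarterTurn n, b⟫ = β ∧ ∃ s t : ℝ, 0 < s ∧ 0 < t ∧ s + t = 1 ∧ s • a + t • b = x := by
  obtain ⟨a, haU, ha1, ha⟩ := h.exists_left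
  obtain ⟨b, hbU, hb1, hb⟩ := h.exists_right
  obtain ⟨hx1, hx2, hx3⟩ := hx
  have hlt := sub_pos.2 h.lt
  refine ⟨a, haU, b, hbU, ha1, ha, hb1, hb, (β - ⟪quarterTurn n, x⟫) / (β - α),
    (⟪quarterTurn n, x⟫ - α) / (β - α), div_pos (by linarith) hlt, div_pos (by linarith) hlt,
    by field_simp; ring, ?_⟩
  apply eq_of_inner_eq_of_inner_quarterTurn_eq h.ne_zero <;>
    simp only [inner_add_right, real_inner_smul_right, ha1, ha, hb1, hb, hx1] <;>
    field_simp <;> ring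

theorem bridgeSegment_subset (h : IsBridge U n α β) :
    bridgeSegment n α β ⊆ convexHull ℝ U := by
  intro x hx
  obtain ⟨a, ha, b, hb, -, -, -, -, s, t, hs, ht, hst, rfl⟩ := h.exists_mem_openSegment hx
  exact convex_convexHull ℝ U (subset_convexHull ℝ U ha) (subset_convexHull ℝ U hb) hs.le ht.le hst

theorem eq_of_mem_bridgeTriangle (h : IsBridge U n α β) (h' : IsBridge U n' α' β') {y : E²}
    (hy : y ∈ bridgeTriangle n α β) (hy' : y ∈ bridgeTriangle n' α' β') :
    n = n' ∧ α = α' ∧ β = β' := by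
  have hx := inv_smul_mem_bridgeSegment hy
  have hx' := inv_smul_mem_bridgeSegment hy'
  have hle := h'.inner_le_of_mem_convexHull (h.bridgeSegment_subset hx)
  have hle' := h.inner_le_of_mem_convexHull (h'.bridgeSegment_subset hx')
  rw [real_inner_smul_right, inv_mul_le_iff₀ hy.1, mul_one] at hle
  rw [real_inner_smul_right, inv_mul_le_iff₀ hy'.1, mul_one] at hle'
  have heq : ⟪n, y⟫ = ⟪n', y⟫ := le_antisymm hle' hle
  rw [← heq] at hx'
  set x := (⟪n, y⟫)⁻¹ • y
  obtain ⟨a, haU, b, hbU, ha1, ha, hb1, hb, s, t, hs, ht, hst, hstx⟩ :=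
    h.exists_mem_openSegment hx
  have hna := h'.inner_le a haU
  have hnb := h'.inner_le b hbU
  have hnx : s * ⟪n', a⟫ + t * ⟪n', b⟫ = 1 := by
    rw [← hx'.1, ← hstx]
    simp only [inner_add_right, real_inner_smul_right]
  have hna' : ⟪n', a⟫ = 1 := by nlinarith
  have hnb' : ⟪n', b⟫ = 1 := by nlinarith
  obtain rfl : n = n' := by
    have e1 := h.lt
    rw [← ha, ← hb] at e1
    simp only [quarterTurn, PiLp.inner_apply, Fin.sum_univ_two] at ha1 hb1 hna' hnb' e1
    simp at ha1 hb1 hna' hnb' e1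
    have hdet : a 0 * b 1 - a 1 * b 0 ≠ 0 := by
      intro h0
      have e2 : (n 0 * b 1 - n 1 * b 0) - (n 0 * a 1 - n 1 * a 0) = 0 := by
        linear_combination (n 0 ^ 2 + n 1 ^ 2) * h0 - (n 0 * b 1 - n 1 * b 0) * ha1 +
          (n 0 * a 1 - n 1 * a 0) * hb1
      linarith
    have h0 : n 0 = n' 0 := mul_left_cancel₀ hdet
      (by linear_combination b 1 * ha1 - a 1 * hb1 - b 1 * hna' + a 1 * hnb')
    have h1 : n 1 = n' 1 := mul_left_cancel₀ hdet
      (by linear_combination -b 0 * ha1 + a 0 * hb1 + b 0 * hna' - a 0 * hnb')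
    ext i
    fin_cases i
    exacts [h0, h1]
  obtain ⟨a', haU', ha1', ha'⟩ := h'.exists_left
  obtain ⟨b', hbU', hb1', hb'⟩ := h'.exists_right
  have g1 := h.gap a' haU' ha1'
  have g2 := h.gap b' hbU' hb1'
  have g3 := h'.gap a haU ha1
  have g4 := h'.gap b hbU hb1
  rw [ha'] at g1
  rw [hb'] at g2
  rw [ha] at g3
  rw [hb] at g4
  have o1 := hx.2
  have o2 := hx'.2
  refine ⟨rfl, le_antisymm ?_ ?_, le_antisymm ?_ ?_⟩
  · by_contra! hc
    linarith [g3 hc]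
  · by_contra! hc
    linarith [g1 hc]
  · exact g2 (by linarith)
  · exact g4 (by linarith)

end IsBridge

open scoped Pointwise

namespace IsBridge

variable {U : Set E²} {n n' : E²} {α β α' β' : ℝ}

theorem disjoint_frontier (h : IsBridge U n α β) (h0 : (0 : E²) ∈ interior (convexHull ℝ U)) :
    Disjoint (bridgeTriangle n α β) (frontier (convexHull ℝ U)) := by
  rw [Set.disjoint_left]
  intro y hy hyf
  apply hyf.2
  have hx := h.bridgeSegment_subset (inv_smul_mem_bridgeSegment hy)
  have := (convex_convexHull ℝ U).combo_interior_self_mem_interior h0 hx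
    (sub_pos.2 hy.2.1) hy.1.le (sub_add_cancel _ _)
  rwa [smul_zero, zero_add, smul_inv_smul₀ hy.1.ne'] at this

theorem exists_mem_frontier (h : IsBridge U n α β) (hU : IsClosed U)
    (hstar : ∀ a ∈ U, ∀ t : ℝ, 0 ≤ t → t < 1 → t • a ∈ interior U) {z : E²}
    (hz : z ∈ bridgeSegment n α β) :
    ∃ y ∈ frontier U ∩ bridgeTriangle n α β, ⟪quarterTurn n, y⟫ = ⟪quarterTurn n, z⟫ := by
  have hn := h.ne_zero
  have hn2 : ⟪n, n⟫ ≠ 0 := inner_self_ne_zero.2 hn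
  set y : ℝ → E² := fun s => z - ((1 - s) * (⟪n, n⟫)⁻¹) • n with hy
  have hy1 : ∀ s, ⟪n, y s⟫ = s := fun s => by
    simp only [hy, inner_sub_right, real_inner_smul_right, hz.1, mul_assoc, inv_mul_cancel₀ hn2]
    ring
  have hy2 : ∀ s, ⟪quarterTurn n, y s⟫ = ⟪quarterTurn n, z⟫ := fun s => by
    simp only [hy, inner_sub_right, real_inner_smul_right, inner_quarterTurn_self]
    ring
  have hy3 : y 1 = z := by simp [hy]
  have hcont : Continuous y := by fun_prop
  have hzU : z ∉ U := fun hzU => (h.gap z hzU hz.1 hz.2.1).not_gt hz.2.2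
  obtain ⟨σ, hσ1, hσU, hσ⟩ : ∃ σ < 1, y σ ∈ interior U ∧
      ∀ s, σ < s → s < 1 → y s ∈ bridgeTriangle n α β := by
    obtain ⟨a, haU, ha1, ha⟩ := h.exists_left
    obtain ⟨b, hbU, hb1, hb⟩ := h.exists_right
    obtain ⟨-, hz2, hz3⟩ := hz
    simp only [bridgeTriangle, Set.mem_ofPred_eq, hy1, hy2]
    set c := ⟪quarterTurn n, z⟫
    rcases le_or_gt 0 c with hc | hc
    · have hβ : 0 < β := by linarith
      have h1 : c / β < 1 := (div_lt_one hβ).2 hz3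
      have h0 : 0 ≤ c / β := by positivity
      refine ⟨c / β, h1, ?_, fun s hs hs1 => ?_⟩
      · convert hstar b hbU _ h0 h1 using 1
        apply eq_of_inner_eq_of_inner_quarterTurn_eq hn
        · rw [hy1, real_inner_smul_right, hb1, mul_one]
        · rw [hy2, real_inner_smul_right, hb, div_mul_cancel₀ _ hβ.ne']
      · rw [div_lt_iff₀ hβ] at hs
        have hs0 : 0 < s := by nlinarith
        exact ⟨hs0, hs1, by nlinarith, by linarith⟩
    · have hα : α < 0 := by linarith
      have h1 : c / α < 1 := (div_lt_one_of_neg hα).2 hz2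
      have h0 : 0 < c / α := div_pos_of_neg_of_neg hc hα
      refine ⟨c / α, h1, ?_, fun s hs hs1 => ?_⟩
      · convert hstar a haU _ h0.le h1 using 1
        apply eq_of_inner_eq_of_inner_quarterTurn_eq hn
        · rw [hy1, real_inner_smul_right, ha1, mul_one]
        · rw [hy2, real_inner_smul_right, ha, div_mul_cancel₀ _ hα.ne]
      · have hs0 : 0 < s := h0.trans hs
        rw [div_lt_iff_of_neg hα] at hs
        exact ⟨hs0, hs1, by linarith, by nlinarith⟩
  obtain ⟨s, hs, hsf⟩ : ∃ s ∈ Set.Icc σ 1, y s ∈ frontier U := by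
    by_contra! hcon
    obtain ⟨w, -, hw1, hw2⟩ := isPreconnected_Icc (a := σ) (b := 1) (y ⁻¹' interior U) (y ⁻¹' Uᶜ)
      (isOpen_interior.preimage hcont) (hU.isOpen_compl.preimage hcont)
      (fun s hs => by
        by_cases hsU : y s ∈ U
        · left
          by_contra hsi
          exact hcon s hs ⟨subset_closure hsU, hsi⟩
        · exact Or.inr hsU)
      ⟨σ, Set.left_mem_Icc.2 hσ1.le, hσU⟩ ⟨1, Set.right_mem_Icc.2 hσ1.le, by simpa [hy3] using hzU⟩
    exact hw2 (interior_subset hw1)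
  have hsσ : s ≠ σ := by
    rintro rfl
    exact hsf.2 hσU
  have hs1 : s ≠ 1 := by
    rintro rfl
    exact hzU (hy3 ▸ hU.frontier_subset hsf)
  exact ⟨y s, ⟨hsf, hσ s (lt_of_le_of_ne hs.1 hsσ.symm) (lt_of_le_of_ne hs.2 hs1)⟩, hy2 s⟩

theorem hausdorffMeasure_bridgeSegment_le (h : IsBridge U n α β) (hU : IsClosed U)
    (hstar : ∀ a ∈ U, ∀ t : ℝ, 0 ≤ t → t < 1 → t • a ∈ interior U) :
    μH[1] (bridgeSegment n α β) ≤ μH[1] (frontier U ∩ bridgeTriangle n α β) := by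
  have hn := h.ne_zero
  have hn2 : 0 < ⟪n, n⟫ := real_inner_self_pos.2 hn
  set π : E² → E² := fun y => y + ((1 - ⟪n, y⟫) / ⟪n, n⟫) • n with hπ
  have hlip : LipschitzWith 1 π := by
    refine LipschitzWith.of_dist_le_mul fun y y' => ?_
    rw [NNReal.coe_one, one_mul, dist_eq_norm, dist_eq_norm]
    have hsub : π y - π y' = (y - y') - (⟪n, y - y'⟫ / ⟪n, n⟫) • n := by
      simp only [hπ, inner_sub_right]
      module
    rw [hsub]
    generalize y - y' = w
    rw [← sq_le_sq₀ (norm_nonneg _) (norm_nonneg _), ← real_inner_self_eq_norm_sq,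
      ← real_inner_self_eq_norm_sq]
    simp only [inner_sub_left, inner_sub_right, real_inner_smul_left, real_inner_smul_right,
      real_inner_comm n w]
    have : ⟪n, w⟫ / ⟪n, n⟫ * ⟪n, n⟫ = ⟪n, w⟫ := div_mul_cancel₀ _ hn2.ne'
    have h2 : 0 ≤ ⟪n, w⟫ / ⟪n, n⟫ * ⟪n, w⟫ := by
      rw [div_mul_eq_mul_div]
      exact div_nonneg (mul_self_nonneg _) hn2.le
    rw [this]
    linarith
  have hsub : bridgeSegment n α β ⊆ π '' (frontier U ∩ bridgeTriangle n α β) := by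
    intro z hz
    obtain ⟨y, hy, hyz⟩ := h.exists_mem_frontier hU hstar hz
    refine ⟨y, hy, eq_of_inner_eq_of_inner_quarterTurn_eq hn ?_ ?_⟩
    · simp only [hπ, inner_add_right, real_inner_smul_right, hz.1, div_mul_cancel₀ _ hn2.ne']
      ring
    · simp only [hπ, inner_add_right, real_inner_smul_right, inner_quarterTurn_self, hyz]
      ring
  calc μH[1] (bridgeSegment n α β) ≤ μH[1] (π '' (frontier U ∩ bridgeTriangle n α β)) :=
        measure_mono hsub
    _ ≤ _ := by simpa using hlip.hausdorffMeasure_image_le zero_le_one _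

end IsBridge

/-- Passing to the convex hull does not increase the perimeter of a compact set that is strictly
star-shaped about the origin. -/
theorem hausdorffMeasure_frontier_convexHull_le {U : Set E²} (hU : IsCompact U)
    (hK : IsClosed (convexHull ℝ U)) (h0 : (0 : E²) ∈ interior U)
    (hstar : ∀ a ∈ U, ∀ t : ℝ, 0 ≤ t → t < 1 → t • a ∈ interior U) :
    μH[1] (frontier (convexHull ℝ U)) ≤ μH[1] (frontier U) := by
  have hint : interior U ⊆ interior (convexHull ℝ U) := interior_mono (subset_convexHull ℝ U)
  let I : Set (E² × ℝ × ℝ) := {i | IsBridge U i.1 i.2.1 i.2.2}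
  let S : E² × ℝ × ℝ → Set E² := fun i => bridgeSegment i.1 i.2.1 i.2.2
  let T : E² × ℝ × ℝ → Set E² := fun i => bridgeTriangle i.1 i.2.1 i.2.2
  have hdisj : I.PairwiseDisjoint T := by
    intro i hi j hj hij
    refine Set.disjoint_left.2 fun y hy hy' => hij ?_
    obtain ⟨h1, h2, h3⟩ := IsBridge.eq_of_mem_bridgeTriangle hi hj hy hy'
    exact Prod.ext h1 (Prod.ext h2 h3)
  have hcount : I.Countable := by
    refine hdisj.countable_of_isOpen (fun i _ => isOpen_bridgeTriangle _ _ _) fun i hi => ?_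
    obtain ⟨a, -, b, -, h⟩ : ∃ a ∈ U, ∃ b ∈ U, (⟪i.1, a⟫ = 1 ∧ ⟪quarterTurn i.1, a⟫ = i.2.1) ∧
        ⟪i.1, b⟫ = 1 ∧ ⟪quarterTurn i.1, b⟫ = i.2.2 := by
      obtain ⟨a, ha, ha'⟩ := hi.exists_left
      obtain ⟨b, hb, hb'⟩ := hi.exists_right
      exact ⟨a, ha, b, hb, ha', hb'⟩
    have hmid : (1 / 2 : ℝ) • (a + b) ∈ S i := by
      have := hi.lt
      simp only [S, bridgeSegment, Set.mem_ofPred_eq, real_inner_smul_right, inner_add_right, h]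
      exact ⟨by norm_num, by linarith, by linarith⟩
    exact ⟨_, smul_mem_bridgeTriangle hmid (t := 1 / 2) (by norm_num) (by norm_num)⟩
  have hcover : frontier (convexHull ℝ U) ⊆ frontier (convexHull ℝ U) ∩ U ∪ ⋃ i ∈ I, S i := by
    intro x hx
    by_cases hxU : x ∈ U
    · exact Or.inl ⟨hx, hxU⟩
    · right
      obtain ⟨m, hm, hm'⟩ :=
        (convex_convexHull ℝ U).exists_inner_le_of_mem_frontier ⟨0, hint h0⟩ hx
      have hpos : 0 < ⟪m, x⟫ := by simpa using hm 0 (hint h0)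
      obtain ⟨α, β, hb, hxb⟩ := exists_isBridge (n := (⟪m, x⟫)⁻¹ • m) hU (hK.frontier_subset hx) hxU
        (fun y hy => by
          rw [real_inner_smul_left, inv_mul_le_iff₀ hpos, mul_one]
          exact hm' y (subset_convexHull ℝ U hy))
        (by rw [real_inner_smul_left, inv_mul_cancel₀ hpos.ne'])
      exact Set.mem_biUnion (x := ((⟪m, x⟫)⁻¹ • m, α, β)) hb hxb
  have hdisj' : Disjoint (frontier (convexHull ℝ U) ∩ U) (⋃ i ∈ I, frontier U ∩ T i) := by
    simp only [Set.disjoint_iUnion_right]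
    exact fun i hi => ((IsBridge.disjoint_frontier hi (hint h0)).symm.mono_left
      Set.inter_subset_left).mono_right Set.inter_subset_right
  have hmeas : ∀ i ∈ I, MeasurableSet (frontier U ∩ T i) := fun i _ =>
    isClosed_frontier.measurableSet.inter (isOpen_bridgeTriangle _ _ _).measurableSet
  calc μH[1] (frontier (convexHull ℝ U))
      ≤ μH[1] (frontier (convexHull ℝ U) ∩ U ∪ ⋃ i ∈ I, S i) := measure_mono hcover
    _ ≤ μH[1] (frontier (convexHull ℝ U) ∩ U) + μH[1] (⋃ i ∈ I, S i) := measure_union_le _ _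
    _ ≤ μH[1] (frontier (convexHull ℝ U) ∩ U) + ∑' i : I, μH[1] (S i) := by
        gcongr
        exact measure_biUnion_le _ hcount _
    _ ≤ μH[1] (frontier (convexHull ℝ U) ∩ U) + ∑' i : I, μH[1] (frontier U ∩ T i) := by
        refine add_le_add_right (ENNReal.tsum_le_tsum fun i => ?_) _
        exact IsBridge.hausdorffMeasure_bridgeSegment_le i.2 hU.isClosed hstar
    _ = μH[1] (frontier (convexHull ℝ U) ∩ U) + μH[1] (⋃ i ∈ I, frontier U ∩ T i) := by
        rw [measure_biUnion hcount
          (hdisj.mono fun i => Set.inter_subset_right) hmeas]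
    _ = μH[1] (frontier (convexHull ℝ U) ∩ U ∪ ⋃ i ∈ I, frontier U ∩ T i) :=
        (measure_union hdisj' (MeasurableSet.biUnion hcount hmeas)).symm
    _ ≤ μH[1] (frontier U) := by
        refine measure_mono (Set.union_subset ?_ ?_)
        · exact fun x hx => ⟨subset_closure hx.2, fun hxi => hx.1.2 (hint hxi)⟩
        · exact Set.iUnion₂_subset fun i _ => Set.inter_subset_left

/-- The bounding curve of a bounded convex set with nonempty interior has finite length. -/
theorem Convex.hausdorffMeasure_frontier_lt_top {K : Set E²} (hK : Convex ℝ K)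
    (hb : Bornology.IsBounded K) (hne : (interior K).Nonempty) : μH[1] (frontier K) < ∞ := by
  obtain ⟨R, hR⟩ := hb.closure.subset_closedBall (0 : E²)
  have hsphere : μH[1] (Metric.sphere (0 : E²) |R|) < ∞ := by
    have himg : Metric.sphere (0 : E²) |R| =
        Complex.orthonormalBasisOneI.repr '' (circleMap 0 R '' Set.Ioc 0 (2 * Real.pi)) := by
      rw [image_circleMap_Ioc, LinearIsometryEquiv.image_sphere, map_zero]
    rw [himg, Complex.orthonormalBasisOneI.repr.isometry.hausdorffMeasure_image
      (Or.inl zero_le_one)]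
    refine ((lipschitzWith_circleMap 0 R).hausdorffMeasure_image_le zero_le_one _).trans_lt ?_
    rw [hausdorffMeasure_real, Real.volume_Ioc]
    exact ENNReal.mul_lt_top (by simp) ENNReal.ofReal_lt_top
  have hpush : ∀ p : frontier K, ∃ w : E², p + w ∈ Metric.sphere (0 : E²) |R| ∧
      ∀ y ∈ closure K, ⟪w, y⟫ ≤ ⟪w, p⟫ := by
    rintro ⟨p, hp⟩
    obtain ⟨n, hn, hn'⟩ := hK.exists_inner_le_of_mem_frontier hne hp
    obtain ⟨o, ho⟩ := hne
    have hn0 : n ≠ 0 := by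
      rintro rfl
      simpa using hn o ho
    have hcont : Continuous fun t : ℝ => ‖p + t • n‖ := by fun_prop
    have hpR : ‖p‖ ≤ |R| := by
      have := hR hp.1
      rw [mem_closedBall_zero_iff] at this
      exact this.trans (le_abs_self R)
    have hnpos : 0 < ‖n‖ := norm_pos_iff.2 hn0
    have hT : 0 ≤ 2 * |R| / ‖n‖ := by positivity
    have hlarge : |R| ≤ ‖p + (2 * |R| / ‖n‖) • n‖ := by
      have h1 : ‖(2 * |R| / ‖n‖) • n‖ = 2 * |R| := by
        rw [norm_smul, Real.norm_of_nonneg hT, div_mul_cancel₀ _ hnpos.ne']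
      have h2 := norm_sub_le (p + (2 * |R| / ‖n‖) • n) p
      rw [add_sub_cancel_left, h1] at h2
      linarith
    obtain ⟨t, ht, htR⟩ := intermediate_value_Icc hT hcont.continuousOn
      ⟨by simpa using hpR, hlarge⟩
    refine ⟨t • n, by simpa using htR, fun y hy => ?_⟩
    have hcl : IsClosed {y : E² | ⟪n, y⟫ ≤ ⟪n, p⟫} := isClosed_le (by fun_prop) (by fun_prop)
    have := closure_minimal hn' hcl hy
    rw [real_inner_smul_left, real_inner_smul_left]
    exact mul_le_mul_of_nonneg_left this ht.1
  choose w hw hw' using hpush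
  have hanti : AntilipschitzWith 1 fun p : frontier K => (p : E²) + w p := by
    refine AntilipschitzWith.of_le_mul_dist fun p q => ?_
    rw [NNReal.coe_one, one_mul, Subtype.dist_eq, dist_eq_norm, dist_eq_norm]
    have h1 := hw' p q q.2.1
    have h2 := hw' q p p.2.1
    rw [← sq_le_sq₀ (norm_nonneg _) (norm_nonneg _)]
    have hexp : ‖(p : E²) + w p - (q + w q)‖ ^ 2 = ‖(p : E²) - q‖ ^ 2 +
        2 * ⟪w p - w q, (p : E²) - q⟫ + ‖w p - w q‖ ^ 2 := by
      rw [show (p : E²) + w p - (q + w q) = (w p - w q) + (p - q) by abel, norm_add_sq_real]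
      ring
    have hnonneg : 0 ≤ ⟪w p - w q, (p : E²) - q⟫ := by
      simp only [inner_sub_left, inner_sub_right]
      linarith
    rw [hexp]
    nlinarith [sq_nonneg ‖w p - w q‖]
  calc μH[1] (frontier K) = μH[1] (Set.univ : Set (frontier K)) := by
        rw [← (isometry_subtype_coe (s := frontier K)).hausdorffMeasure_image
          (Or.inl zero_le_one), Set.image_univ, Subtype.range_coe]
    _ ≤ μH[1] ((fun p : frontier K => (p : E²) + w p) '' Set.univ) := by
        simpa using hanti.le_hausdorffMeasure_image zero_le_one Set.univ
    _ ≤ μH[1] (Metric.sphere (0 : E²) |R|) := by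
        refine measure_mono ?_
        rintro _ ⟨p, -, rfl⟩
        exact hw p
    _ < ∞ := hsphere

theorem IsCompact.convexHull_union {E : Type*} [AddCommGroup E] [Module ℝ E] [TopologicalSpace E]
    [ContinuousAdd E] [ContinuousSMul ℝ E] {A B : Set E} (hA : IsCompact A) (hB : IsCompact B)
    (hAc : Convex ℝ A) (hBc : Convex ℝ B) (hAne : A.Nonempty) (hBne : B.Nonempty) :
    IsCompact (convexHull ℝ (A ∪ B)) := by
  have himg : convexHull ℝ (A ∪ B) =
      (fun q : ℝ × E × E => (1 - q.1) • q.2.1 + q.1 • q.2.2) '' (Set.Icc 0 1 ×ˢ A ×ˢ B) := by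
    rw [hAc.convexHull_union hBc hAne hBne]
    ext x
    simp only [mem_convexJoin, segment_eq_image, Set.mem_image, Set.mem_prod, Prod.exists]
    constructor
    · rintro ⟨a, ha, b, hb, t, ht, rfl⟩
      exact ⟨t, a, b, ⟨ht, ha, hb⟩, rfl⟩
    · rintro ⟨t, a, b, ⟨ht, ha, hb⟩, rfl⟩
      exact ⟨a, ha, b, hb, t, ht, rfl⟩
  rw [himg]
  exact (isCompact_Icc.prod (hA.prod hB)).image (by fun_prop)

theorem hausdorffMeasure_frontier_vadd (c : E²) (s : Set E²) :
    μH[1] (frontier (c +ᵥ s)) = μH[1] (frontier s) := by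
  have h : frontier (c +ᵥ s) = c +ᵥ frontier s := ((Homeomorph.vadd c).image_frontier s).symm
  rw [h, hausdorffMeasure_vadd c (Or.inl zero_le_one)]

theorem hausdorffMeasure_frontier_convexHull_union_le {A B : Set E²} (hA : IsCompact A)
    (hB : IsCompact B) (hAc : Convex ℝ A) (hBc : Convex ℝ B)
    (hmeet : (interior A ∩ interior B).Nonempty) :
    μH[1] (frontier (convexHull ℝ (A ∪ B))) ≤ μH[1] (frontier A) + μH[1] (frontier B) := by
  obtain ⟨o, hoA, hoB⟩ := hmeet
  wlog ho : o = 0 generalizing A B o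
  · have hint : ∀ s : Set E², o ∈ interior s → (0 : E²) ∈ interior (-o +ᵥ s) := fun s hs => by
      rw [interior_vadd]
      exact ⟨o, hs, by simp⟩
    have := this (hA.vadd (-o)) (hB.vadd (-o)) (hAc.vadd (-o)) (hBc.vadd (-o)) 0
      (hint A hoA) (hint B hoB) rfl
    rwa [← Set.vadd_set_union, convexHull_vadd, hausdorffMeasure_frontier_vadd,
      hausdorffMeasure_frontier_vadd, hausdorffMeasure_frontier_vadd] at this
  subst ho
  have hstar : ∀ s : Set E², Convex ℝ s → 0 ∈ interior s → ∀ a ∈ s, ∀ t : ℝ, 0 ≤ t → t < 1 →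
      t • a ∈ interior s := fun s hs h0 a ha t ht ht1 => by
    simpa using hs.combo_interior_self_mem_interior h0 ha (sub_pos.2 ht1) ht (sub_add_cancel _ _)
  have hcl : IsClosed (convexHull ℝ (A ∪ B)) :=
    (hA.convexHull_union hB hAc hBc ⟨0, interior_subset hoA⟩ ⟨0, interior_subset hoB⟩).isClosed
  have hsubA : interior A ⊆ interior (A ∪ B) := interior_mono Set.subset_union_left
  have hsubB : interior B ⊆ interior (A ∪ B) := interior_mono Set.subset_union_right
  calc μH[1] (frontier (convexHull ℝ (A ∪ B))) ≤ μH[1] (frontier (A ∪ B)) :=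
        hausdorffMeasure_frontier_convexHull_le (hA.union hB) hcl (hsubA hoA)
          fun a ha t ht ht1 => ha.elim
            (fun ha => hsubA (hstar A hAc hoA a ha t ht ht1))
            fun ha => hsubB (hstar B hBc hoB a ha t ht ht1)
    _ ≤ μH[1] (frontier A ∪ frontier B) := by
        refine measure_mono ((frontier_union_subset A B).trans ?_)
        exact Set.union_subset_union Set.inter_subset_left Set.inter_subset_right
    _ ≤ _ := measure_union_le _ _

theorem perim_hull_union_le_of_interiors_meet
    (A B : Set (EuclideanSpace ℝ (Fin 2)))
    (hAne : A.Nonempty) (hBne : B.Nonempty)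
    (hAcpt : IsCompact A) (hBcpt : IsCompact B)
    (hAconv : Convex ℝ A) (hBconv : Convex ℝ B)
    (hmeet : (interior A ∩ interior B).Nonempty) :
    perim (convexHull ℝ (A ∪ B)) ≤ perim A + perim B := by
  have hA := (hAconv.hausdorffMeasure_frontier_lt_top hAcpt.isBounded
    (hmeet.mono Set.inter_subset_left)).ne
  have hB := (hBconv.hausdorffMeasure_frontier_lt_top hBcpt.isBounded
    (hmeet.mono Set.inter_subset_right)).ne
  rw [perim, perim, perim, ← ENNReal.toReal_add hA hB]
  exact ENNReal.toReal_mono (ENNReal.add_ne_top.2 ⟨hA, hB⟩)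
    (hausdorffMeasure_frontier_convexHull_union_le hAcpt hBcpt hAconv hBconv hmeet)
end

section
/- (Lemma 1, strict form.) Let A and B be compact convex subsets of ℝ², each with nonempty interior, such that (interior A ∩ interior B) is nonempty. Then μH¹(frontier (convexHull ℝ (A ∪ B))) < μH¹(frontier A) + μH¹(frontier B): the perimeter of the convex hull of A ∪ B is strictly less than the sum of the perimeters of A and B. -/
open MeasureTheory

local notation "E₂" => EuclideanSpace ℝ (Fin 2)

/-- The determinant of two plane vectors. -/
noncomputable def planeCross (x y : E₂) : ℝ := x 0 * y 1 - x 1 * y 0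

/-- The open cone spanned by `a` and `b`, for a positively oriented pair `(a, b)`. -/
def openSector (a b : E₂) : Set E₂ := {z | 0 < planeCross z b ∧ 0 < planeCross a z}

lemma continuous_planeCross_left (b : E₂) : Continuous fun z => planeCross z b := by
  unfold planeCross; fun_prop

lemma continuous_planeCross_right (a : E₂) : Continuous fun z => planeCross a z := by
  unfold planeCross; fun_prop

lemma isOpen_openSector (a b : E₂) : IsOpen (openSector a b) :=
  (isOpen_lt continuous_const (continuous_planeCross_left b)).inter
    (isOpen_lt continuous_const (continuous_planeCross_right a))

lemma planeCross_smul_eq (a b z : E₂) :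
    planeCross a b • z = planeCross z b • a + planeCross a z • b := by
  ext i
  fin_cases i <;> simp [planeCross] <;> ring

lemma exists_eq_smul_add_smul {a b : E₂} (hab : 0 < planeCross a b) (z : E₂) :
    z = (planeCross z b / planeCross a b) • a + (planeCross a z / planeCross a b) • b := by
  have h := planeCross_smul_eq a b z
  rw [div_eq_inv_mul, div_eq_inv_mul, mul_smul, mul_smul, ← smul_add, ← h, smul_smul,
    inv_mul_cancel₀ hab.ne', one_smul]

lemma smul_add_smul_mem_openSector {a b : E₂} (hab : 0 < planeCross a b) {s t : ℝ}
    (hs : 0 < s) (ht : 0 < t) : s • a + t • b ∈ openSector a b := by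
  constructor
  · have : planeCross (s • a + t • b) b = s * planeCross a b := by
      simp [planeCross]; ring
    rw [this]; positivity
  · have : planeCross a (s • a + t • b) = t * planeCross a b := by
      simp [planeCross]; ring
    rw [this]; positivity

lemma mem_openSector_iff {a b : E₂} (hab : 0 < planeCross a b) {z : E₂} :
    z ∈ openSector a b ↔ ∃ s t : ℝ, 0 < s ∧ 0 < t ∧ z = s • a + t • b := by
  constructor
  · rintro ⟨h1, h2⟩
    exact ⟨_, _, div_pos h1 hab, div_pos h2 hab, exists_eq_smul_add_smul hab z⟩
  · rintro ⟨s, t, hs, ht, rfl⟩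
    exact smul_add_smul_mem_openSector hab hs ht

lemma openSegment_subset_openSector {a b : E₂} (hab : 0 < planeCross a b) :
    openSegment ℝ a b ⊆ openSector a b := by
  rintro _ ⟨s, t, hs, ht, -, rfl⟩
  exact smul_add_smul_mem_openSector hab hs ht

/-- A length bound for a set whose orthogonal shadow on the line `ab` covers the segment. -/
lemma edist_le_hausdorffMeasure {a b : E₂} (hab : a ≠ b) {s : Set E₂}
    (hs : ∀ p ∈ openSegment ℝ a b, ∃ v ∈ s, inner ℝ (b - a) v = inner ℝ (b - a) p) :
    edist a b ≤ μH[1] s := by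
  set u := b - a
  have hu : 0 < ‖u‖ := norm_pos_iff.2 (sub_ne_zero.2 hab.symm)
  have hlip : LipschitzWith ‖u‖₊ (innerSL ℝ u) := by
    have h := (innerSL ℝ u).lipschitz
    rwa [show ‖innerSL ℝ u‖₊ = ‖u‖₊ from NNReal.eq (innerSL_apply_norm ℝ u)] at h
  have h1 : μH[1] (innerSL ℝ u '' s) ≤ ENNReal.ofReal ‖u‖ * μH[1] s := by
    have := hlip.hausdorffMeasure_image_le (d := 1) zero_le_one s
    rwa [ENNReal.rpow_one, ← enorm_eq_nnnorm, ← ofReal_norm] at this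
  have h2 : Set.Ioo (inner ℝ u a) (inner ℝ u b) ⊆ innerSL ℝ u '' s := by
    rw [← openSegment_eq_Ioo]
    · rintro _ ⟨x, y, hx, hy, hxy, rfl⟩
      obtain ⟨v, hv, hvp⟩ := hs (x • a + y • b) ⟨x, y, hx, hy, hxy, rfl⟩
      refine ⟨v, hv, ?_⟩
      rw [innerSL_apply_apply, hvp, inner_add_right, inner_smul_right, inner_smul_right]
      rfl
    · rw [← sub_pos, ← inner_sub_right, real_inner_self_eq_norm_sq]
      positivity
  have h3 : ENNReal.ofReal ‖u‖ * ENNReal.ofReal ‖u‖ ≤ ENNReal.ofReal ‖u‖ * μH[1] s := by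
    refine le_trans (le_of_eq ?_) ((measure_mono h2).trans h1)
    rw [hausdorffMeasure_real, Real.volume_Ioo, ← inner_sub_right, real_inner_self_eq_norm_sq,
      ← ENNReal.ofReal_mul hu.le, sq]
  have h4 := (ENNReal.mul_le_mul_iff_right (by simpa using hu) ENNReal.ofReal_ne_top).1 h3
  rwa [edist_comm, edist_dist, dist_eq_norm]

/-- Continuity and positive homogeneity of degree one. -/
structure IsContPosHom (g : E₂ → ℝ) : Prop where
  continuous : Continuous g
  map_smul : ∀ (t : ℝ) (x : E₂), 0 ≤ t → g (t • x) = t * g x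

/-- A segment of the level set `{g = 1}` with end points in `{h = 1}` and interior in
`{1 < h}`. -/
structure IsBridge_s7 (g h : E₂ → ℝ) (a b : E₂) : Prop where
  cross_pos : 0 < planeCross a b
  left_eq : h a = 1
  right_eq : h b = 1
  eq_one : ∀ p ∈ segment ℝ a b, g p = 1
  one_lt : ∀ p ∈ openSegment ℝ a b, 1 < h p

namespace IsBridge_s7

variable {g h : E₂ → ℝ} {a b c d : E₂}

lemma mem_openSegment (hg : IsContPosHom g) (H : IsBridge_s7 g h a b) {z : E₂}
    (hz : z ∈ openSector a b) (hgz : g z = 1) : z ∈ openSegment ℝ a b := by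
  obtain ⟨s, t, hs, ht, rfl⟩ := (mem_openSector_iff H.cross_pos).1 hz
  have hst : 0 < s + t := by positivity
  have hmem : (s / (s + t)) • a + (t / (s + t)) • b ∈ segment ℝ a b :=
    ⟨_, _, by positivity, by positivity, by field_simp, rfl⟩
  have heq : s • a + t • b = (s + t) • ((s / (s + t)) • a + (t / (s + t)) • b) := by
    rw [smul_add, smul_smul, smul_smul, mul_div_cancel₀ _ hst.ne', mul_div_cancel₀ _ hst.ne']
  rw [heq, hg.map_smul _ _ hst.le, H.eq_one _ hmem, mul_one] at hgz
  exact ⟨s, t, hs, ht, hgz, rfl⟩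

lemma not_one_lt_smul_left (hg : IsContPosHom g) (H : IsBridge_s7 g h a b) {r : ℝ}
    (hr : 0 ≤ r) (hg1 : g (r • a) = 1) : ¬ 1 < h (r • a) := by
  rw [hg.map_smul _ _ hr, H.eq_one _ (left_mem_segment ℝ a b), mul_one] at hg1
  rw [hg1, one_smul, H.left_eq]
  exact lt_irrefl _

lemma not_one_lt_smul_right (hg : IsContPosHom g) (H : IsBridge_s7 g h a b) {r : ℝ}
    (hr : 0 ≤ r) (hg1 : g (r • b) = 1) : ¬ 1 < h (r • b) := by
  rw [hg.map_smul _ _ hr, H.eq_one _ (right_mem_segment ℝ a b), mul_one] at hg1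
  rw [hg1, one_smul, H.right_eq]
  exact lt_irrefl _

lemma openSector_subset (hg : IsContPosHom g) (H : IsBridge_s7 g h a b)
    (K : IsBridge_s7 g h c d) (hne : (openSector a b ∩ openSector c d).Nonempty) :
    openSector c d ⊆ openSector a b := by
  have hpre : IsPreconnected (openSegment ℝ c d) := (convex_openSegment c d).isPreconnected
  have hsub : openSegment ℝ c d ⊆ openSector a b := by
    refine hpre.subset_left_of_subset_union (isOpen_openSector a b)
      (v := {z | planeCross z b < 0} ∪ {z | planeCross a z < 0})
      ((isOpen_lt (continuous_planeCross_left b) continuous_const).union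
        (isOpen_lt (continuous_planeCross_right a) continuous_const)) ?_ ?_ ?_
    · rw [Set.disjoint_left]
      rintro z ⟨h1, h2⟩ (h3 | h3)
      · exact lt_asymm h1 h3
      · exact lt_asymm h2 h3
    · intro w hw
      by_contra hcon
      simp only [openSector, Set.mem_union, Set.mem_ofPred_eq, not_or, not_and_or, not_lt] at hcon
      obtain ⟨h1, h2, h3⟩ := hcon
      have hgw := K.eq_one w (openSegment_subset_segment ℝ c d hw)
      have hhw := K.one_lt w hw
      have hw' := exists_eq_smul_add_smul H.cross_pos w
      rcases h1 with h1 | h1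
      · rw [le_antisymm h1 h2, zero_div, zero_smul, zero_add] at hw'
        have hr : 0 ≤ planeCross a w / planeCross a b := div_nonneg h3 H.cross_pos.le
        rw [hw'] at hgw hhw
        exact H.not_one_lt_smul_right hg hr hgw hhw
      · rw [le_antisymm h1 h3, zero_div, zero_smul, add_zero] at hw'
        have hr : 0 ≤ planeCross w b / planeCross a b := div_nonneg h2 H.cross_pos.le
        rw [hw'] at hgw hhw
        exact H.not_one_lt_smul_left hg hr hgw hhw
    · obtain ⟨z, hz1, hz2⟩ := hne
      obtain ⟨s, t, hs, ht, rfl⟩ := (mem_openSector_iff K.cross_pos).1 hz2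
      have hst : 0 < s + t := by positivity
      refine ⟨(s / (s + t)) • c + (t / (s + t)) • d,
        ⟨_, _, by positivity, by positivity, by field_simp, rfl⟩, ?_⟩
      obtain ⟨s', t', hs', ht', heq⟩ := (mem_openSector_iff H.cross_pos).1 hz1
      refine (mem_openSector_iff H.cross_pos).2
        ⟨s' / (s + t), t' / (s + t), by positivity, by positivity, ?_⟩
      rw [div_eq_inv_mul, div_eq_inv_mul, div_eq_inv_mul, div_eq_inv_mul, mul_smul, mul_smul,
        mul_smul, mul_smul, ← smul_add, ← smul_add, heq]
  intro z hz
  obtain ⟨s, t, hs, ht, rfl⟩ := (mem_openSector_iff K.cross_pos).1 hz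
  have hst : 0 < s + t := by positivity
  obtain ⟨s', t', hs', ht', heq⟩ := (mem_openSector_iff H.cross_pos).1
    (hsub ⟨s / (s + t), t / (s + t), by positivity, by positivity, by field_simp, rfl⟩)
  refine (mem_openSector_iff H.cross_pos).2
    ⟨(s + t) * s', (s + t) * t', by positivity, by positivity, ?_⟩
  rw [mul_smul, mul_smul, ← smul_add, ← heq, smul_add, smul_smul, smul_smul,
    mul_div_cancel₀ _ hst.ne', mul_div_cancel₀ _ hst.ne']

lemma exists_level_inner_eq (hh : IsContPosHom h) (H : IsBridge_s7 g h a b) {p : E₂}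
    (hp : p ∈ openSegment ℝ a b) :
    ∃ v ∈ {x | h x = 1} ∩ openSector a b, inner ℝ (b - a) v = inner ℝ (b - a) p := by
  set u := b - a
  have hab : inner ℝ u a < inner ℝ u b := by
    have hne : u ≠ 0 := by
      intro h0
      have := H.cross_pos
      rw [sub_eq_zero.1 h0] at this
      simp [planeCross, mul_comm] at this
    have := norm_pos_iff.2 hne
    rw [← sub_pos, ← inner_sub_right, real_inner_self_eq_norm_sq]
    positivity
  obtain ⟨s, t, hs, ht, hst, hpe⟩ := id hp
  have hip : inner ℝ u p = s * inner ℝ u a + t * inner ℝ u b := by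
    rw [← hpe, inner_add_right, inner_smul_right, inner_smul_right]
  have hpa : inner ℝ u a < inner ℝ u p := by
    have : s = 1 - t := by linarith
    subst this
    rw [hip]; nlinarith
  have hpb : inner ℝ u p < inner ℝ u b := by
    have : t = 1 - s := by linarith
    subst this
    rw [hip]; nlinarith
  -- the line through `p` orthogonal to `ab` leaves the triangle with vertices `0`, `a`, `b` at `q`
  obtain ⟨q, ⟨s', t', hs', ht', rfl⟩, hhq, hq⟩ : ∃ q : E₂,
      (∃ s' t' : ℝ, 0 ≤ s' ∧ 0 ≤ t' ∧ q = s' • a + t' • b) ∧ h q < 1 ∧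
        inner ℝ u q = inner ℝ u p := by
    rcases le_or_gt 0 (inner ℝ u p) with h0 | h0
    · have hb0 : 0 < inner ℝ u b := h0.trans_lt hpb
      have hr : 0 ≤ inner ℝ u p / inner ℝ u b := by positivity
      refine ⟨(inner ℝ u p / inner ℝ u b) • b, ⟨0, _, le_rfl, hr, by simp⟩, ?_, ?_⟩
      · rw [hh.map_smul _ _ hr, H.right_eq, mul_one, div_lt_one hb0]
        exact hpb
      · rw [inner_smul_right, div_mul_cancel₀ _ hb0.ne']
    · have ha0 : inner ℝ u a < 0 := hpa.trans h0
      have hr : 0 ≤ inner ℝ u p / inner ℝ u a := div_nonneg_of_nonpos h0.le ha0.le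
      refine ⟨(inner ℝ u p / inner ℝ u a) • a, ⟨_, 0, hr, le_rfl, by simp⟩, ?_, ?_⟩
      · rw [hh.map_smul _ _ hr, H.left_eq, mul_one, div_lt_one_of_neg ha0]
        exact hpa
      · rw [inner_smul_right, div_mul_cancel₀ _ ha0.ne]
  set q := s' • a + t' • b with hqdef
  have hcont : ContinuousOn (fun τ : ℝ => h ((1 - τ) • p + τ • q)) (Set.Icc 0 1) :=
    (hh.continuous.comp (by fun_prop)).continuousOn
  obtain ⟨τ, hτ, hτ1⟩ := intermediate_value_Icc' zero_le_one hcont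
    (show (1 : ℝ) ∈ _ by simpa using ⟨hhq.le, (H.one_lt p hp).le⟩)
  have hτlt : τ < 1 := by
    refine lt_of_le_of_ne hτ.2 ?_
    rintro rfl
    simp only [sub_self, zero_smul, one_smul, zero_add] at hτ1
    exact hhq.ne hτ1
  have h1τ : 0 < 1 - τ := by linarith
  have hτ0 := hτ.1
  refine ⟨(1 - τ) • p + τ • q, ⟨hτ1, ?_⟩, ?_⟩
  · refine (mem_openSector_iff H.cross_pos).2
      ⟨(1 - τ) * s + τ * s', (1 - τ) * t + τ * t', by positivity, by positivity, ?_⟩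
    rw [← hpe, hqdef]
    module
  · rw [inner_add_right, inner_smul_right, inner_smul_right, hq]
    ring

lemma hausdorffMeasure_le (hg : IsContPosHom g) (hh : IsContPosHom h) (H : IsBridge_s7 g h a b) :
    μH[1] ({x | g x = 1} ∩ openSector a b) ≤ μH[1] ({x | h x = 1} ∩ openSector a b) := by
  have hab : a ≠ b := by
    rintro rfl
    have := H.cross_pos
    simp [planeCross, mul_comm] at this
  calc μH[1] ({x | g x = 1} ∩ openSector a b) ≤ μH[1] (segment ℝ a b) :=
        measure_mono fun z hz =>
          openSegment_subset_segment ℝ a b (H.mem_openSegment hg hz.2 hz.1)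
    _ = edist a b := hausdorffMeasure_segment a b
    _ ≤ _ := edist_le_hausdorffMeasure hab fun p hp => H.exists_level_inner_eq hh hp

end IsBridge_s7

theorem hausdorffMeasure_level_le {g h : E₂ → ℝ} (hg : IsContPosHom g) (hh : IsContPosHom h)
    (hle : ∀ x, g x ≤ h x)
    (hbridge : ∀ p, g p = 1 → 1 < h p → ∃ a b, IsBridge_s7 g h a b ∧ p ∈ openSegment ℝ a b) :
    μH[1] {x | g x = 1} ≤ μH[1] {x | h x = 1} := by
  set 𝒮 : Set (Set E₂) := {S | ∃ a b, IsBridge_s7 g h a b ∧ S = openSector a b}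
  have hopen : ∀ S ∈ 𝒮, IsOpen S := by
    rintro _ ⟨a, b, -, rfl⟩
    exact isOpen_openSector a b
  have hdisj : 𝒮.PairwiseDisjoint id := by
    rintro _ ⟨a, b, H, rfl⟩ _ ⟨c, d, K, rfl⟩ hne
    rw [Function.onFun, id, id, Set.disjoint_iff_inter_eq_empty]
    by_contra hcon
    rw [← ne_eq, ← Set.nonempty_iff_ne_empty] at hcon
    exact hne ((K.openSector_subset hg H (Set.inter_comm _ _ ▸ hcon)).antisymm
      (H.openSector_subset hg K hcon))
  have hcount : 𝒮.Countable := hdisj.countable_of_isOpen hopen (by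
    rintro _ ⟨a, b, H, rfl⟩
    exact ⟨_, smul_add_smul_mem_openSector H.cross_pos one_pos one_pos⟩)
  have hW : MeasurableSet (⋃₀ 𝒮) := (isOpen_sUnion hopen).measurableSet
  have hh1 : MeasurableSet {x | h x = 1} :=
    (isClosed_eq hh.continuous continuous_const).measurableSet
  have hout : {x | g x = 1} \ ⋃₀ 𝒮 ⊆ {x | h x = 1} \ ⋃₀ 𝒮 := by
    rintro p ⟨hp, hpW⟩
    refine ⟨?_, hpW⟩
    by_contra hne
    have hlt : 1 < h p := lt_of_le_of_ne ((show g p = 1 from hp) ▸ hle p) (Ne.symm hne)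
    obtain ⟨a, b, H, hpab⟩ := hbridge p hp hlt
    exact hpW ⟨_, ⟨a, b, H, rfl⟩, openSegment_subset_openSector H.cross_pos hpab⟩
  have hin : μH[1] ({x | g x = 1} ∩ ⋃₀ 𝒮) ≤ μH[1] ({x | h x = 1} ∩ ⋃₀ 𝒮) := by
    have := hcount.to_subtype
    rw [Set.sUnion_eq_iUnion, Set.inter_iUnion, Set.inter_iUnion]
    refine (measure_iUnion_le _).trans ?_
    rw [measure_iUnion]
    · refine ENNReal.tsum_le_tsum ?_
      rintro ⟨_, a, b, H, rfl⟩
      exact H.hausdorffMeasure_le hg hh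
    · intro S T hST
      exact (hdisj S.2 T.2 (fun h => hST (Subtype.ext h))).mono
        Set.inter_subset_right Set.inter_subset_right
    · exact fun S => hh1.inter (hopen _ S.2).measurableSet
  rw [← measure_inter_add_sdiff {x | g x = 1} hW, ← measure_inter_add_sdiff {x | h x = 1} hW]
  exact add_le_add hin (measure_mono hout)

lemma exists_last_le_one {φ : ℝ → ℝ} (hφ : Continuous φ) {l τ : ℝ} (hlτ : l ≤ τ) (hl : φ l ≤ 1)
    (hτ : 1 < φ τ) : ∃ t, l ≤ t ∧ t < τ ∧ φ t = 1 ∧ ∀ r, t < r → r ≤ τ → 1 < φ r := by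
  have hK : IsCompact (Set.Icc l τ ∩ {t | φ t ≤ 1}) :=
    isCompact_Icc.inter_right (isClosed_le hφ continuous_const)
  obtain ⟨t, ⟨⟨ht1, ht2⟩, ht3⟩, hmax⟩ := hK.exists_isGreatest ⟨l, ⟨le_rfl, hlτ⟩, hl⟩
  have hlast : ∀ r, t < r → r ≤ τ → 1 < φ r := fun r h1 h2 => by
    by_contra hcon
    exact h1.not_ge (hmax ⟨⟨ht1.trans h1.le, h2⟩, not_lt.1 hcon⟩)
  have htτ : t < τ := lt_of_le_of_ne ht2 (by rintro rfl; exact hτ.not_ge ht3)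
  refine ⟨t, ht1, htτ, ?_, hlast⟩
  obtain ⟨r, hr, hr1⟩ := intermediate_value_Icc ht2 hφ.continuousOn
    (show (1 : ℝ) ∈ _ from ⟨ht3, hτ.le⟩)
  rcases hr.1.eq_or_lt with rfl | hlt
  · exact hr1
  · exact absurd hr1 (hlast r hlt hr.2).ne'

lemma planeCross_swap (a b : E₂) : planeCross b a = -planeCross a b := by
  unfold planeCross; ring

lemma exists_eq_smul_of_planeCross_eq_zero {a b : E₂} (ha : a ≠ 0) (hab : planeCross a b = 0) :
    ∃ r : ℝ, b = r • a := by
  have hpos : 0 < a 0 ^ 2 + a 1 ^ 2 := by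
    by_contra hcon
    refine ha ?_
    ext i
    fin_cases i <;> simp <;> nlinarith [sq_nonneg (a 0), sq_nonneg (a 1)]
  unfold planeCross at hab
  refine ⟨(a 0 * b 0 + a 1 * b 1) / (a 0 ^ 2 + a 1 ^ 2), ?_⟩
  ext i
  fin_cases i
  · simp only [Fin.zero_eta, PiLp.smul_apply, smul_eq_mul]
    field_simp
    linear_combination (-a 1) * hab
  · simp only [Fin.mk_one, PiLp.smul_apply, smul_eq_mul]
    field_simp
    linear_combination (a 0) * hab

lemma exists_isBridge_s7 {g h : E₂ → ℝ} (hg : IsContPosHom g) (hh : IsContPosHom h)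
    (hconv : ConvexOn ℝ Set.univ g) {x y p : E₂} (hp : p ∈ segment ℝ x y)
    (hgx : g x ≤ 1) (hgy : g y ≤ 1) (hhx : h x ≤ 1) (hhy : h y ≤ 1)
    (hgp : g p = 1) (hhp : 1 < h p) :
    ∃ a b, IsBridge_s7 g h a b ∧ p ∈ openSegment ℝ a b := by
  have hg0 : g 0 = 0 := by simpa using hg.map_smul 0 0 le_rfl
  rw [segment_eq_image_lineMap] at hp
  obtain ⟨τ, ⟨hτ0, hτ1⟩, rfl⟩ := hp
  set L : ℝ →ᵃ[ℝ] E₂ := AffineMap.lineMap x y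
  have hL : Continuous L := AffineMap.lineMap_continuous
  have hL0 : L 0 = x := AffineMap.lineMap_apply_zero x y
  have hL1 : L 1 = y := AffineMap.lineMap_apply_one x y
  obtain ⟨t₁, ht₁0, ht₁τ, ht₁, hl₁⟩ := exists_last_le_one (φ := fun t => h (L t))
    (hh.continuous.comp hL) hτ0 (by simpa only [hL0] using hhx) hhp
  obtain ⟨t₂, ht₂0, ht₂τ, ht₂, hl₂⟩ := exists_last_le_one (φ := fun t => h (L (-t)))
    (hh.continuous.comp (hL.comp continuous_neg)) (neg_le_neg hτ1)
    (by simpa only [neg_neg, hL1] using hhy) (by simpa only [neg_neg] using hhp)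
  obtain ⟨t₂, rfl⟩ : ∃ s, t₂ = -s := ⟨-t₂, (neg_neg t₂).symm⟩
  simp only [neg_neg] at ht₂
  have ht₂1 : t₂ ≤ 1 := by linarith
  have ht₂τ' : τ < t₂ := by linarith
  have hG : ConvexOn ℝ Set.univ (g ∘ L) := by simpa using hconv.comp_affineMap L
  have hGle : ∀ t ∈ Set.Icc (0 : ℝ) 1, (g ∘ L) t ≤ 1 := fun t ht => by
    refine (hG.le_max_of_mem_Icc (Set.mem_univ 0) (Set.mem_univ 1) ht).trans (max_le ?_ ?_)
    · simpa only [Function.comp_apply, hL0] using hgx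
    · simpa only [Function.comp_apply, hL1] using hgy
  have hGeq : ∀ t ∈ Set.Icc t₁ t₂, g (L t) = 1 := fun t ht => by
    by_contra hne
    have hlt : (g ∘ L) t < (g ∘ L) τ := by
      rw [Function.comp_apply, Function.comp_apply, hgp]
      exact lt_of_le_of_ne (hGle t ⟨ht₁0.trans ht.1, ht.2.trans ht₂1⟩) hne
    rcases lt_trichotomy t τ with h1 | rfl | h1
    · have hmem : τ ∈ openSegment ℝ t t₂ := by
        rw [openSegment_eq_Ioo (h1.trans ht₂τ')]; exact ⟨h1, ht₂τ'⟩
      have h2 := hG.lt_right_of_left_lt (Set.mem_univ _) (Set.mem_univ _) hmem hlt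
      have h3 := hGle t₂ ⟨hτ0.trans ht₂τ'.le, ht₂1⟩
      rw [Function.comp_apply, hgp] at h2
      exact h2.not_ge h3
    · exact lt_irrefl _ hlt
    · have hmem : τ ∈ openSegment ℝ t₁ t := by
        rw [openSegment_eq_Ioo (ht₁τ.trans h1)]; exact ⟨ht₁τ, h1⟩
      have h2 := hG.lt_left_of_right_lt (Set.mem_univ _) (Set.mem_univ _) hmem hlt
      have h3 := hGle t₁ ⟨ht₁0, ht₁τ.le.trans hτ1⟩
      rw [Function.comp_apply, hgp] at h2
      exact h2.not_ge h3
  have ht₁₂ : t₁ < t₂ := ht₁τ.trans ht₂τ'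
  have hseg : ∀ q ∈ segment ℝ (L t₁) (L t₂), g q = 1 := by
    rw [← image_segment, segment_eq_Icc ht₁₂.le]
    rintro _ ⟨t, ht, rfl⟩
    exact hGeq t ht
  have hopen : ∀ q ∈ openSegment ℝ (L t₁) (L t₂), 1 < h q := by
    rw [← image_openSegment, openSegment_eq_Ioo ht₁₂]
    rintro _ ⟨t, ht, rfl⟩
    rcases le_total t τ with h1 | h1
    · exact hl₁ t ht.1 h1
    · simpa only [neg_neg] using hl₂ (-t) (neg_lt_neg ht.2) (neg_le_neg h1)
  have hpmem : L τ ∈ openSegment ℝ (L t₁) (L t₂) := by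
    rw [← image_openSegment, openSegment_eq_Ioo ht₁₂]
    exact ⟨τ, ⟨ht₁τ, ht₂τ'⟩, rfl⟩
  generalize L t₁ = a, L t₂ = b at *
  rcases lt_trichotomy (planeCross a b) 0 with hc | hc | hc
  · refine ⟨b, a, ⟨by rw [planeCross_swap]; linarith, ht₂, ht₁, ?_, ?_⟩, ?_⟩
    · rwa [segment_symm]
    · rwa [openSegment_symm]
    · rwa [openSegment_symm]
  · exfalso
    have hga := hseg a (left_mem_segment ℝ a b)
    have hgb := hseg b (right_mem_segment ℝ a b)
    have ha : a ≠ 0 := by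
      rintro rfl
      rw [hg0] at hga
      exact zero_ne_one hga
    obtain ⟨r, rfl⟩ := exists_eq_smul_of_planeCross_eq_zero ha hc
    rcases le_or_gt 0 r with hr | hr
    · rw [hg.map_smul _ _ hr, hga, mul_one] at hgb
      rw [hgb, one_smul, openSegment_same, Set.mem_singleton_iff] at hpmem
      rw [hpmem, ht₁] at hhp
      exact lt_irrefl _ hhp
    · have h1r : 0 < 1 - r := by linarith
      have h0 : (0 : E₂) ∈ segment ℝ a (r • a) := by
        refine ⟨-r / (1 - r), 1 / (1 - r), div_nonneg (by linarith) h1r.le, by positivity,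
          by field_simp; ring, ?_⟩
        rw [smul_smul, ← add_smul]
        convert zero_smul ℝ a using 2
        field_simp
        ring
      have := hseg 0 h0
      rw [hg0] at this
      exact zero_ne_one this
  · exact ⟨a, b, ⟨hc, ht₁, ht₂, hseg, hopen⟩, hpmem⟩

/-- Level sets of continuous positively homogeneous functions have positive length near each
of their points. -/
lemma hausdorffMeasure_level_inter_pos {f : E₂ → ℝ} (hf : IsContPosHom f) {x : E₂} (hx : f x = 1)
    {O : Set E₂} (hO : IsOpen O) (hxO : x ∈ O) : 0 < μH[1] ({y | f y = 1} ∩ O) := by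
  obtain ⟨r, hr, hrO⟩ := Metric.isOpen_iff.1 hO x hxO
  have hx0 : x ≠ 0 := by
    rintro rfl
    have := hf.map_smul 0 0 le_rfl
    simp only [zero_smul, zero_mul] at this
    linarith
  have hsmul : Filter.Tendsto (fun ε : ℝ => ((1 - ε) • x, (1 + ε) • x)) (nhds 0) (nhds (x, x)) := by
    have : Continuous (fun ε : ℝ => ((1 - ε) • x, (1 + ε) • x)) := by fun_prop
    simpa using this.tendsto 0
  have hball := hsmul.eventually (prod_mem_nhds (Metric.ball_mem_nhds x hr)
    (Metric.ball_mem_nhds x hr))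
  obtain ⟨ε, ⟨⟨hp, hq⟩, hε1⟩, hε⟩ :=
    (((hball.and (Iio_mem_nhds one_pos)).filter_mono nhdsWithin_le_nhds).and
      self_mem_nhdsWithin : ∀ᶠ ε in nhdsWithin (0 : ℝ) (Set.Ioi 0), _).exists
  replace hε1 : ε < 1 := hε1
  replace hε : 0 < ε := hε
  set p := (1 - ε) • x with hpdef
  set q := (1 + ε) • x with hqdef
  have hfp : f p < 1 := by rw [hf.map_smul _ _ (by linarith), hx]; linarith
  have hfq : 1 < f q := by rw [hf.map_smul _ _ (by linarith), hx]; linarith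
  set w : E₂ := !₂[-x 1, x 0]
  have hwx : inner ℝ w x = 0 := by
    simp [w, PiLp.inner_apply, Fin.sum_univ_two]; ring
  have hw0 : 0 < ‖w‖ ^ 2 := by
    have : w ≠ 0 := by
      intro h
      refine hx0 ?_
      have h0 : w 0 = 0 := by rw [h]; rfl
      have h1 : w 1 = 0 := by rw [h]; rfl
      simp only [w, Matrix.cons_val_zero, Matrix.cons_val_one] at h0 h1
      ext i
      fin_cases i
      · exact h1
      · exact neg_eq_zero.1 h0
    have := norm_pos_iff.2 this
    positivity
  have himage : innerSL ℝ w '' ({y | f y = 1} ∩ O) ∈ nhds (0 : ℝ) := by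
    have hcp : Continuous fun s : ℝ => p + (s / ‖w‖ ^ 2) • w := by fun_prop
    have hcq : Continuous fun s : ℝ => q + (s / ‖w‖ ^ 2) • w := by fun_prop
    have e1 : ∀ᶠ s in nhds (0 : ℝ), f (p + (s / ‖w‖ ^ 2) • w) < 1 :=
      (hf.continuous.comp hcp).continuousAt.eventually_lt_const (by simpa using hfp)
    have e2 : ∀ᶠ s in nhds (0 : ℝ), 1 < f (q + (s / ‖w‖ ^ 2) • w) :=
      (hf.continuous.comp hcq).continuousAt.eventually_const_lt (by simpa using hfq)
    have e3 : ∀ᶠ s in nhds (0 : ℝ), p + (s / ‖w‖ ^ 2) • w ∈ Metric.ball x r :=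
      hcp.continuousAt.eventually_mem (Metric.isOpen_ball.mem_nhds (by simpa using hp))
    have e4 : ∀ᶠ s in nhds (0 : ℝ), q + (s / ‖w‖ ^ 2) • w ∈ Metric.ball x r :=
      hcq.continuousAt.eventually_mem (Metric.isOpen_ball.mem_nhds (by simpa using hq))
    filter_upwards [e1, e2, e3, e4] with s h1 h2 h3 h4
    obtain ⟨y, hy, hy1⟩ := (convex_segment (𝕜 := ℝ) (p + (s / ‖w‖ ^ 2) • w)
      (q + (s / ‖w‖ ^ 2) • w)).isPreconnected.intermediate_value (left_mem_segment ℝ _ _)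
      (right_mem_segment ℝ _ _) hf.continuous.continuousOn ⟨h1.le, h2.le⟩
    refine ⟨y, ⟨hy1, hrO ((convex_ball x r).segment_subset h3 h4 hy)⟩, ?_⟩
    obtain ⟨α, β, -, -, hαβ, rfl⟩ := hy
    rw [innerSL_apply_apply, hpdef, hqdef]
    simp only [inner_add_right, inner_smul_right, hwx, real_inner_self_eq_norm_sq]
    rw [div_mul_cancel₀ _ hw0.ne']
    linear_combination s * hαβ
  have hpos : 0 < μH[1] (innerSL ℝ w '' ({y | f y = 1} ∩ O)) := by
    rw [hausdorffMeasure_real]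
    exact Measure.measure_pos_of_mem_nhds _ himage
  by_contra hcon
  rw [not_lt, nonpos_iff_eq_zero] at hcon
  have := (innerSL ℝ w).lipschitz.hausdorffMeasure_image_le (d := 1) zero_le_one
    ({y | f y = 1} ∩ O)
  rw [hcon, mul_zero] at this
  exact hpos.not_ge this

lemma hausdorffMeasure_unit_sphere_lt_top : μH[1] (Metric.sphere (0 : E₂) 1) < ⊤ := by
  have hC : μH[1] (Metric.sphere (0 : ℂ) 1) < ⊤ := by
    have h := image_circleMap_Ioc 0 1
    rw [abs_one] at h
    rw [← h]
    refine ((lipschitzWith_circleMap 0 1).hausdorffMeasure_image_le zero_le_one _).trans_lt ?_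
    rw [hausdorffMeasure_real, Real.volume_Ioc]
    simp [ENNReal.mul_lt_top]
  have h := Complex.orthonormalBasisOneI.repr.toIsometryEquiv.hausdorffMeasure_image 1
    (Metric.sphere (0 : ℂ) 1)
  rw [IsometryEquiv.image_sphere] at h
  simp only [LinearIsometryEquiv.coe_toIsometryEquiv, map_zero] at h
  rwa [h]

lemma hausdorffMeasure_level_lt_top {f : E₂ → ℝ} (hf : IsContPosHom f) {K : NNReal}
    (hlip : LipschitzWith K f) {c : ℝ} (hc : 0 < c) (hfc : ∀ x, c * ‖x‖ ≤ f x) :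
    μH[1] {x | f x = 1} < ⊤ := by
  have hsub : {x | f x = 1} ⊆ (fun x => (f x)⁻¹ • x) '' Metric.sphere (0 : E₂) 1 := by
    intro x hx
    have hx1 : f x = 1 := hx
    have hx0 : 0 < ‖x‖ := norm_pos_iff.2 (by
      rintro rfl
      have := hf.map_smul 0 0 le_rfl
      simp only [zero_smul, zero_mul] at this
      linarith)
    refine ⟨‖x‖⁻¹ • x, by simp [norm_smul, hx0.ne'], ?_⟩
    simp only
    rw [hf.map_smul _ _ (by positivity), hx1, mul_one, inv_inv, smul_smul,
      mul_inv_cancel₀ hx0.ne', one_smul]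
  have hL : LipschitzOnWith (Real.toNNReal (c⁻¹ + c⁻¹ * c⁻¹ * K)) (fun x => (f x)⁻¹ • x)
      (Metric.sphere (0 : E₂) 1) := by
    refine LipschitzOnWith.of_dist_le_mul fun x hx y hy => ?_
    rw [Real.coe_toNNReal _ (by positivity)]
    rw [mem_sphere_zero_iff_norm] at hx hy
    have hfx : c ≤ f x := by simpa [hx] using hfc x
    have hfy : c ≤ f y := by simpa [hy] using hfc y
    have hfx0 := hc.trans_le hfx
    have hfy0 := hc.trans_le hfy
    have hfxy : |f y - f x| ≤ K * dist x y := by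
      rw [dist_comm x y]; simpa [Real.dist_eq] using hlip.dist_le_mul y x
    have hix : (f x)⁻¹ ≤ c⁻¹ := inv_anti₀ hc hfx
    have hiy : (f y)⁻¹ ≤ c⁻¹ := inv_anti₀ hc hfy
    have heq : (f x)⁻¹ • x - (f y)⁻¹ • y
        = (f x)⁻¹ • (x - y) + ((f x)⁻¹ * (f y)⁻¹ * (f y - f x)) • y := by
      have : (f x)⁻¹ * (f y)⁻¹ * (f y - f x) = (f x)⁻¹ - (f y)⁻¹ := by
        field_simp
      rw [this]
      module
    rw [dist_eq_norm, heq]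
    refine (norm_add_le _ _).trans ?_
    rw [norm_smul, norm_smul, hy, mul_one, ← dist_eq_norm, Real.norm_eq_abs, Real.norm_eq_abs,
      abs_mul, abs_of_pos (inv_pos.2 hfx0),
      abs_of_pos (mul_pos (inv_pos.2 hfx0) (inv_pos.2 hfy0)), add_mul, mul_assoc _ (K : ℝ)]
    gcongr
  refine (measure_mono hsub).trans_lt ((hL.hausdorffMeasure_image_le zero_le_one).trans_lt ?_)
  rw [ENNReal.rpow_one]
  exact ENNReal.mul_lt_top ENNReal.coe_lt_top hausdorffMeasure_unit_sphere_lt_top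

lemma isContPosHom_gauge {s : Set E₂} (hs : Convex ℝ s) (h0 : s ∈ nhds 0) :
    IsContPosHom (gauge s) :=
  ⟨continuous_gauge hs h0, fun t x ht => by rw [gauge_smul_of_nonneg ht, smul_eq_mul]⟩

lemma frontier_eq_gauge_level {s : Set E₂} (hs : Convex ℝ s) (h0 : s ∈ nhds 0) :
    frontier s = {x | gauge s x = 1} :=
  Set.ext fun _ => (gauge_eq_one_iff_mem_frontier hs h0).symm

lemma convexOn_gauge {s : Set E₂} (hs : Convex ℝ s) (h0 : s ∈ nhds 0) :
    ConvexOn ℝ Set.univ (gauge s) := by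
  refine ⟨convex_univ, fun x _ y _ a b ha hb _ => ?_⟩
  rw [← gauge_smul_of_nonneg ha, ← gauge_smul_of_nonneg hb]
  exact gauge_add_le hs (absorbent_nhds_zero h0) _ _

lemma exists_pos_mul_norm_le_gauge {s : Set E₂} (hs : IsCompact s) (h0 : s ∈ nhds 0) :
    ∃ c > 0, ∀ x, c * ‖x‖ ≤ gauge s x := by
  obtain ⟨R, hR, hsR⟩ := hs.isBounded.subset_closedBall_lt 0 0
  refine ⟨R⁻¹, inv_pos.2 hR, fun x => ?_⟩
  rw [inv_mul_eq_div]
  exact le_gauge_of_subset_closedBall (absorbent_nhds_zero h0) hR.le hsR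

lemma hausdorffMeasure_frontier_lt_top {s : Set E₂} (hcpt : IsCompact s) (hs : Convex ℝ s)
    (h0 : s ∈ nhds 0) : μH[1] (frontier s) < ⊤ := by
  rw [frontier_eq_gauge_level hs h0]
  obtain ⟨K, hK⟩ := hs.lipschitz_gauge h0
  obtain ⟨c, hc, hcs⟩ := exists_pos_mul_norm_le_gauge hcpt h0
  exact hausdorffMeasure_level_lt_top (isContPosHom_gauge hs h0) hK hc hcs

lemma isCompact_convexHull_union {A B : Set E₂} (hAcpt : IsCompact A) (hBcpt : IsCompact B)
    (hA : Convex ℝ A) (hB : Convex ℝ B) (hAne : A.Nonempty) (hBne : B.Nonempty) :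
    IsCompact (convexHull ℝ (A ∪ B)) := by
  have h : convexHull ℝ (A ∪ B) =
      (fun z : (E₂ × E₂) × ℝ => (1 - z.2) • z.1.1 + z.2 • z.1.2) ''
        ((A ×ˢ B) ×ˢ Set.Icc 0 1) := by
    rw [hA.convexHull_union hB hAne hBne]
    ext p
    simp only [mem_convexJoin, segment_eq_image, Set.mem_image, Set.mem_prod, Prod.exists]
    constructor
    · rintro ⟨a, ha, b, hb, t, ht, rfl⟩
      exact ⟨a, b, t, ⟨⟨ha, hb⟩, ht⟩, rfl⟩
    · rintro ⟨a, b, t, ⟨⟨ha, hb⟩, ht⟩, rfl⟩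
      exact ⟨a, ha, b, hb, t, ht, rfl⟩
  rw [h]
  exact ((hAcpt.prod hBcpt).prod isCompact_Icc).image (by fun_prop)

lemma hausdorffMeasure_min_level_lt {f g : E₂ → ℝ} (hf : IsContPosHom f) (hg : IsContPosHom g)
    (hffin : μH[1] {x | f x = 1} < ⊤) (hgfin : μH[1] {x | g x = 1} < ⊤)
    {x : E₂} (hfx : f x = 1) (hgx : g x < 1) :
    μH[1] {x | min (f x) (g x) = 1} < μH[1] {x | f x = 1} + μH[1] {x | g x = 1} := by
  have hO : IsOpen {x | g x < 1} := isOpen_lt hg.continuous continuous_const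
  have hsub : {x | min (f x) (g x) = 1} ⊆ ({x | f x = 1} \ {x | g x < 1}) ∪ {x | g x = 1} := by
    intro y hy
    have hy1 : min (f y) (g y) = 1 := hy
    rcases min_choice (f y) (g y) with h | h
    · exact Or.inl ⟨h.symm.trans hy1, not_lt.2 (hy1.symm.le.trans (min_le_right _ _))⟩
    · exact Or.inr (h.symm.trans hy1)
  refine ((measure_mono hsub).trans (measure_union_le _ _)).trans_lt ?_
  refine ENNReal.add_lt_add_right hgfin.ne ?_
  rw [← measure_inter_add_sdiff {x | f x = 1} hO.measurableSet, add_comm]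
  refine ENNReal.lt_add_right ?_ (hausdorffMeasure_level_inter_pos hf hfx hO hgx).ne'
  exact ((measure_mono Set.sdiff_subset).trans_lt hffin).ne

lemma le_of_level_le {f g : E₂ → ℝ} (hf : IsContPosHom f) (hg : IsContPosHom g)
    (hfpos : ∀ x, x ≠ 0 → 0 < f x) (h : ∀ x, f x = 1 → 1 ≤ g x) (x : E₂) : f x ≤ g x := by
  rcases eq_or_ne x 0 with rfl | hx
  · have h1 := hf.map_smul 0 0 le_rfl
    have h2 := hg.map_smul 0 0 le_rfl
    simp only [zero_smul, zero_mul] at h1 h2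
    rw [h1, h2]
  · have hfx := hfpos x hx
    have h1 := h ((f x)⁻¹ • x) (by
      rw [hf.map_smul _ _ (by positivity), inv_mul_cancel₀ hfx.ne'])
    rwa [hg.map_smul _ _ (by positivity), inv_mul_eq_div, one_le_div hfx] at h1

theorem hausdorffMeasure_frontier_convexHull_union_lt {A B : Set E₂} (hAcpt : IsCompact A)
    (hBcpt : IsCompact B) (hA : Convex ℝ A) (hB : Convex ℝ B) (hA0 : A ∈ nhds 0)
    (hB0 : B ∈ nhds 0) :
    μH[1] (frontier (convexHull ℝ (A ∪ B))) < μH[1] (frontier A) + μH[1] (frontier B) := by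
  have hAne : A.Nonempty := ⟨0, mem_of_mem_nhds hA0⟩
  have hBne : B.Nonempty := ⟨0, mem_of_mem_nhds hB0⟩
  have hAC : A ⊆ convexHull ℝ (A ∪ B) := Set.subset_union_left.trans (subset_convexHull ℝ _)
  have hBC : B ⊆ convexHull ℝ (A ∪ B) := Set.subset_union_right.trans (subset_convexHull ℝ _)
  have hC : Convex ℝ (convexHull ℝ (A ∪ B)) := convex_convexHull ℝ _
  have hC0 : convexHull ℝ (A ∪ B) ∈ nhds 0 := Filter.mem_of_superset hA0 hAC
  have hCclosed := (isCompact_convexHull_union hAcpt hBcpt hA hB hAne hBne).isClosed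
  have hgA := isContPosHom_gauge hA hA0
  have hgB := isContPosHom_gauge hB hB0
  have hgC := isContPosHom_gauge hC hC0
  have hAfin := hausdorffMeasure_frontier_lt_top hAcpt hA hA0
  have hBfin := hausdorffMeasure_frontier_lt_top hBcpt hB hB0
  have hmin : IsContPosHom fun x => min (gauge A x) (gauge B x) :=
    ⟨hgA.continuous.min hgB.continuous, fun t x ht => by
      rw [hgA.map_smul t x ht, hgB.map_smul t x ht, mul_min_of_nonneg _ _ ht]⟩
  have hle : μH[1] (frontier (convexHull ℝ (A ∪ B)))
      ≤ μH[1] {x | min (gauge A x) (gauge B x) = 1} := by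
    rw [frontier_eq_gauge_level hC hC0]
    refine hausdorffMeasure_level_le hgC hmin (fun x => le_min
      (gauge_mono (absorbent_nhds_zero hA0) hAC x)
      (gauge_mono (absorbent_nhds_zero hB0) hBC x)) fun p hgp hhp => ?_
    have hpC : p ∈ convexHull ℝ (A ∪ B) :=
      hCclosed.frontier_subset ((gauge_eq_one_iff_mem_frontier hC hC0).1 hgp)
    rw [hA.convexHull_union hB hAne hBne, mem_convexJoin] at hpC
    obtain ⟨a, ha, b, hb, hp⟩ := hpC
    exact exists_isBridge_s7 hgC hmin (convexOn_gauge hC hC0) hp (gauge_le_one_of_mem (hAC ha))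
      (gauge_le_one_of_mem (hBC hb)) ((min_le_left _ _).trans (gauge_le_one_of_mem ha))
      ((min_le_right _ _).trans (gauge_le_one_of_mem hb)) hgp hhp
  refine hle.trans_lt ?_
  rw [frontier_eq_gauge_level hA hA0] at hAfin ⊢
  rw [frontier_eq_gauge_level hB hB0] at hBfin ⊢
  by_cases h1 : ∃ x, gauge A x = 1 ∧ gauge B x < 1
  · obtain ⟨x, hx, hx'⟩ := h1
    exact hausdorffMeasure_min_level_lt hgA hgB hAfin hBfin hx hx'
  by_cases h2 : ∃ x, gauge B x = 1 ∧ gauge A x < 1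
  · obtain ⟨x, hx, hx'⟩ := h2
    have := hausdorffMeasure_min_level_lt hgB hgA hBfin hAfin hx hx'
    simpa only [min_comm, add_comm] using this
  push Not at h1 h2
  obtain ⟨c, hc, hcA⟩ := exists_pos_mul_norm_le_gauge hAcpt hA0
  obtain ⟨d, hd, hdB⟩ := exists_pos_mul_norm_le_gauge hBcpt hB0
  have hApos : ∀ x, x ≠ 0 → 0 < gauge A x := fun x hx =>
    (mul_pos hc (norm_pos_iff.2 hx)).trans_le (hcA x)
  have hBpos : ∀ x, x ≠ 0 → 0 < gauge B x := fun x hx =>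
    (mul_pos hd (norm_pos_iff.2 hx)).trans_le (hdB x)
  have heq : gauge A = gauge B := funext fun x =>
    (le_of_level_le hgA hgB hApos h1 x).antisymm (le_of_level_le hgB hgA hBpos h2 x)
  rw [← heq] at hBfin ⊢
  simp only [min_self]
  obtain ⟨e, he⟩ := exists_ne (0 : E₂)
  have hlevel : gauge A ((gauge A e)⁻¹ • e) = 1 := by
    rw [hgA.map_smul _ _ (gauge_nonneg _ |> inv_nonneg.2), inv_mul_cancel₀ (hApos e he).ne']
  have hpos := hausdorffMeasure_level_inter_pos hgA hlevel isOpen_univ (Set.mem_univ _)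
  rw [Set.inter_univ] at hpos
  exact ENNReal.lt_add_right hAfin.ne hpos.ne'

lemma hausdorffMeasure_frontier_translate (v : E₂) (s : Set E₂) :
    μH[1] (frontier ((fun x => x + v) '' s)) = μH[1] (frontier s) := by
  have h := (IsometryEquiv.addRight v).hausdorffMeasure_image 1 (frontier s)
  have h' := (Homeomorph.addRight v).image_frontier s
  rw [Homeomorph.coe_addRight] at h'
  rw [← h']
  exact h

theorem perim_hull_union_lt_of_interiors_meet
    (A B : Set (EuclideanSpace ℝ (Fin 2)))
    (hAcpt : IsCompact A) (hBcpt : IsCompact B)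
    (hAconv : Convex ℝ A) (hBconv : Convex ℝ B)
    (hAint : (interior A).Nonempty) (hBint : (interior B).Nonempty)
    (hmeet : (interior A ∩ interior B).Nonempty) :
    perim (convexHull ℝ (A ∪ B)) < perim A + perim B := by
  obtain ⟨o, hoA, hoB⟩ := hmeet
  have hnhds : ∀ s : Set E₂, o ∈ interior s → (fun x => x + -o) '' s ∈ nhds 0 := fun s hs => by
    have h := (Homeomorph.addRight (-o)).isOpenMap.image_mem_nhds (mem_interior_iff_mem_nhds.1 hs)
    simpa using h
  have hcpt : ∀ s : Set E₂, IsCompact s → IsCompact ((fun x => x + -o) '' s) := fun s hs =>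
    hs.image (by fun_prop)
  have hconv : ∀ s : Set E₂, Convex ℝ s → Convex ℝ ((fun x => x + -o) '' s) := fun s hs => by
    simpa only [add_comm] using hs.translate (-o)
  have hhull : convexHull ℝ ((fun x => x + -o) '' A ∪ (fun x => x + -o) '' B)
      = (fun x => x + -o) '' convexHull ℝ (A ∪ B) := by
    rw [← Set.image_union]
    exact (AffineMap.image_convexHull (AffineMap.id ℝ E₂ + AffineMap.const ℝ E₂ (-o)) (A ∪ B)).symm
  have hlt := hausdorffMeasure_frontier_convexHull_union_lt (hcpt A hAcpt) (hcpt B hBcpt)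
    (hconv A hAconv) (hconv B hBconv) (hnhds A hoA) (hnhds B hoB)
  have hAfin := hausdorffMeasure_frontier_lt_top (hcpt A hAcpt) (hconv A hAconv) (hnhds A hoA)
  have hBfin := hausdorffMeasure_frontier_lt_top (hcpt B hBcpt) (hconv B hBconv) (hnhds B hoB)
  rw [hhull] at hlt
  simp only [hausdorffMeasure_frontier_translate] at hlt hAfin hBfin
  rw [perim, perim, perim, ← ENNReal.toReal_add hAfin.ne hBfin.ne]
  exact (ENNReal.toReal_lt_toReal hlt.ne_top (ENNReal.add_ne_top.2 ⟨hAfin.ne, hBfin.ne⟩)).2 hlt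
end
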